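/- arXiv:2006.09480 — 5 statements merged into one kernel-verified Lean document; each statement's English description precedes it below -/
import Mathlib

section
/- Let α₀,α₁,…,α₈ be real Leslie coefficients with γ₁ := α₃ − α₂ and γ₂ := α₆ − α₅ satisfying the Parodi relation γ₂ = α₂ + α₃ and the empirical inequalities α₄ > 0; 2α₁ + 3α₄ + 2α₅ + 2α₆ > 0; γ₁ > 0; 2α₄ + α₅ + α₆ > 0; 4γ₁(2α₄ + α₅ + α₆) > (α₂ + α₃ + γ₂)²; α₄ + α₇ > α₁ + γ₂²/γ₁ ≥ 0; and 2α₄ + α₅ + α₆ − γ₂²/γ₁ > α₀ + α₁ + α₅ + α₆ + α₈ ≥ 0. Then there exist constants 0 < λ ≤ Λ < ∞ such that for every n ∈ ℝ and every y = (y₁, y₂) ∈ ℝ², λ(y₁² + y₂²) ≤ yᵀ A(n) y ≤ Λ(y₁² + y₂²), where A(n) is the 2×2 matrix of viscous coefficients defined below. -/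
open Real

noncomputable section

/-- Entries of the `2 × 2` viscous coefficient matrix `A(n)` of the one-dimensional
compressible Ericksen–Leslie system. -/
def A11 (a0 a1 a4 a5 a6 a7 a8 n : ℝ) : ℝ :=
  (a0 + a5 + a6 + a8) * cos n ^ 2 + a1 * cos n ^ 4 + (a4 + a7)

def A12 (a0 a1 a2 a3 a5 a6 n : ℝ) : ℝ :=
  a0 * cos n * sin n + a1 * cos n ^ 3 * sin n
    + (1 / 2) * (a2 + a3 + a5 + a6) * cos n * sin n

def A21 (a1 a6 a8 n : ℝ) : ℝ :=
  a1 * cos n ^ 3 * sin n + (a6 + a8) * cos n * sin n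

def A22 (a1 a2 a3 a4 a5 a6 n : ℝ) : ℝ :=
  a1 * cos n ^ 2 * sin n ^ 2 + (1 / 2) * (-a2 + a5) * cos n ^ 2
    + (1 / 2) * (a3 + a6) * sin n ^ 2 + (1 / 2) * a4

/-- The quadratic form `yᵀ A(n) y` associated with the matrix `A(n)`. -/
def quadA (a0 a1 a2 a3 a4 a5 a6 a7 a8 n y1 y2 : ℝ) : ℝ :=
  A11 a0 a1 a4 a5 a6 a7 a8 n * y1 ^ 2
    + (A12 a0 a1 a2 a3 a5 a6 n + A21 a1 a6 a8 n) * y1 * y2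
    + A22 a1 a2 a3 a4 a5 a6 n * y2 ^ 2

theorem aux_q (x y : ℝ) : 0 ≤ x ^ 2 - x * y + y ^ 2 := by
  nlinarith [sq_nonneg (x - y), sq_nonneg x, sq_nonneg y]

theorem aux_bd (a x N : ℝ) (h1 : x ≤ N) (h2 : -N ≤ x) : a * x ≤ |a| * N := by
  calc a * x ≤ |a * x| := le_abs_self _
    _ = |a| * |x| := abs_mul _ _
    _ ≤ |a| * N := mul_le_mul_of_nonneg_left (abs_le.mpr ⟨h2, h1⟩) (abs_nonneg _)

set_option maxHeartbeats 4000000 in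
/-- Under the Parodi relation and the empirical inequalities on the
Leslie coefficients, the matrix `A(n)` is uniformly elliptic: there are constants
`0 < λ ≤ Λ < ∞` with `λ |y|² ≤ yᵀ A(n) y ≤ Λ |y|²` for all `n ∈ ℝ`, `y ∈ ℝ²`. -/
theorem uniform_ellipticity_of_A
    (a0 a1 a2 a3 a4 a5 a6 a7 a8 : ℝ)
    (hParodi : a6 - a5 = a2 + a3)
    (h1 : 0 < a4)
    (h2 : 0 < 2 * a1 + 3 * a4 + 2 * a5 + 2 * a6)
    (h3 : 0 < a3 - a2)
    (h4 : 0 < 2 * a4 + a5 + a6)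
    (h5 : (a2 + a3 + (a6 - a5)) ^ 2 < 4 * (a3 - a2) * (2 * a4 + a5 + a6))
    (h6 : a1 + (a6 - a5) ^ 2 / (a3 - a2) < a4 + a7)
    (h6' : 0 ≤ a1 + (a6 - a5) ^ 2 / (a3 - a2))
    (h7 : a0 + a1 + a5 + a6 + a8 < 2 * a4 + a5 + a6 - (a6 - a5) ^ 2 / (a3 - a2))
    (h7' : 0 ≤ a0 + a1 + a5 + a6 + a8) :
    ∃ lam Lam : ℝ, 0 < lam ∧ lam ≤ Lam ∧
      ∀ n y1 y2 : ℝ,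
        lam * (y1 ^ 2 + y2 ^ 2) ≤ quadA a0 a1 a2 a3 a4 a5 a6 a7 a8 n y1 y2 ∧
        quadA a0 a1 a2 a3 a4 a5 a6 a7 a8 n y1 y2 ≤ Lam * (y1 ^ 2 + y2 ^ 2) := by
  obtain ⟨k, hk⟩ : ∃ k, k = (a6 - a5) ^ 2 / (a3 - a2) := ⟨_, rfl⟩
  obtain ⟨r, hr⟩ : ∃ r, r = (a6 - a5) / (a3 - a2) := ⟨_, rfl⟩
  rw [← hk] at h6 h6' h7
  have hrg : a6 - a5 = r * (a3 - a2) := by rw [hr]; field_simp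
  have hkr : k = r ^ 2 * (a3 - a2) := by rw [hk, hr]; field_simp
  obtain ⟨l, hl⟩ : ∃ l, l = min (a4 + a7 - (a1 + k))
    ((2 * a4 + a5 + a6 - k - (a0 + a1 + a5 + a6 + a8)) / 4) := ⟨_, rfl⟩
  have hl0 : 0 < l := by
    rw [hl]; apply lt_min <;> linarith
  have hl1 : l ≤ a4 + a7 - (a1 + k) := hl ▸ min_le_left _ _
  have hl2 : l ≤ (2 * a4 + a5 + a6 - k - (a0 + a1 + a5 + a6 + a8)) / 4 := hl ▸ min_le_right _ _
  refine ⟨l, l + |a1| + |a0 + a8 + a5 + a6| + |a6 - a5| * 2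
    + |(a3 - a2 + (2 * a4 + a5 + a6)) / 4| + |a4 + a7|, hl0, ?_, ?_⟩
  · have := abs_nonneg a1
    have := abs_nonneg (a0 + a8 + a5 + a6)
    have := abs_nonneg (a6 - a5)
    have := abs_nonneg ((a3 - a2 + (2 * a4 + a5 + a6)) / 4)
    have := abs_nonneg (a4 + a7)
    linarith
  intro n y z
  unfold quadA A11 A12 A21 A22
  have hcs := Real.sin_sq_add_cos_sq n
  generalize Real.sin n = s at *
  generalize Real.cos n = c at *
  have hs2 : s ^ 2 = 1 - c ^ 2 := by linarith
  have hc1 : c ^ 2 ≤ 1 := by nlinarith [sq_nonneg s]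
  have hs1 : s ^ 2 ≤ 1 := by nlinarith [sq_nonneg c]
  obtain ⟨W, hW⟩ : ∃ W, W = c * y + s * z := ⟨_, rfl⟩
  have hWN : W ^ 2 ≤ y ^ 2 + z ^ 2 := by
    have : y ^ 2 + z ^ 2 - W ^ 2 = (s * y - c * z) ^ 2 := by
      rw [hW]; linear_combination (-(y ^ 2 + z ^ 2)) * hcs
    nlinarith [sq_nonneg (s * y - c * z)]
  have hXN : (c * W) ^ 2 ≤ y ^ 2 + z ^ 2 := by
    rw [mul_pow]; nlinarith [sq_nonneg W]
  have e1 : ((a0 + a5 + a6 + a8) * c ^ 2 + a1 * c ^ 4 + (a4 + a7)) * y ^ 2 +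
        (a0 * c * s + a1 * c ^ 3 * s + 1 / 2 * (a2 + a3 + a5 + a6) * c * s +
              (a1 * c ^ 3 * s + (a6 + a8) * c * s)) * y * z +
        (a1 * c ^ 2 * s ^ 2 + 1 / 2 * (-a2 + a5) * c ^ 2 + 1 / 2 * (a3 + a6) * s ^ 2 +
          1 / 2 * a4) * z ^ 2
      = a1 * (c * W) ^ 2 + (a0 + a8 + a5 + a6) * (c * W * y)
        + (a6 - a5) * (c * s * y * z + (s ^ 2 - c ^ 2) / 2 * z ^ 2)
        + (a3 - a2 + (2 * a4 + a5 + a6)) / 4 * z ^ 2 + (a4 + a7) * y ^ 2 := by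
    have e3 : a3 = a6 - a5 - a2 := by linarith
    subst e3
    rw [hW]
    have e2 : c ^ 2 = 1 - s ^ 2 := by linarith
    linear_combination (1 / 4 * z ^ 2 * (a6 + a5 + (a6 - a5) - 2 * a2)) * hcs
  rw [e1]
  constructor
  · have e2 : a1 * (c * W) ^ 2 + (a0 + a8 + a5 + a6) * (c * W * y)
        + (a6 - a5) * (c * s * y * z + (s ^ 2 - c ^ 2) / 2 * z ^ 2)
        + (a3 - a2 + (2 * a4 + a5 + a6)) / 4 * z ^ 2 + (a4 + a7) * y ^ 2
      = (a3 - a2) * ((1 + r * (s ^ 2 - c ^ 2)) / 2 * z + r * (c * s) * y) ^ 2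
        + (a1 + k) * ((c * W) ^ 2 - c * W * y + y ^ 2)
        + (a0 + a1 + a5 + a6 + a8) * ((c * y + s * z / 2) ^ 2 + (c * z / 2) ^ 2)
        + (a4 + a7 - (a1 + k)) * y ^ 2
        + (2 * a4 + a5 + a6 - k - (a0 + a1 + a5 + a6 + a8)) / 4 * z ^ 2 := by
      have q1 : (c * y + s * z / 2) ^ 2 + (c * z / 2) ^ 2 = c * W * y + z ^ 2 / 4 := by
        rw [hW]; linear_combination (z ^ 2 / 4) * hcs
      have q2 : (s ^ 2 - c ^ 2) ^ 2 * z ^ 2 / 4 + (s ^ 2 - c ^ 2) * (c * s) * y * z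
          + (c * s) ^ 2 * y ^ 2 + (c * W) ^ 2 - c * W * y - z ^ 2 / 4 = 0 := by
        rw [hW]
        have e4 : s ^ 4 = (1 - c ^ 2) ^ 2 := by rw [← hs2]; ring
        have e3 : s ^ 3 = (1 - c ^ 2) * s := by rw [← hs2]; ring
        ring_nf
        rw [e4, e3, hs2]
        ring
      rw [q1, hkr, hrg]
      linear_combination (-(r ^ 2 * (a3 - a2))) * q2
    rw [e2]
    have p1 : 0 ≤ (a3 - a2) * ((1 + r * (s ^ 2 - c ^ 2)) / 2 * z + r * (c * s) * y) ^ 2 :=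
      mul_nonneg h3.le (sq_nonneg _)
    have p2 : 0 ≤ (a1 + k) * ((c * W) ^ 2 - c * W * y + y ^ 2) :=
      mul_nonneg h6' (aux_q _ _)
    have p3 : 0 ≤ (a0 + a1 + a5 + a6 + a8) * ((c * y + s * z / 2) ^ 2 + (c * z / 2) ^ 2) :=
      mul_nonneg h7' (add_nonneg (sq_nonneg _) (sq_nonneg _))
    have p4 := mul_le_mul_of_nonneg_right hl1 (sq_nonneg y)
    have p5 := mul_le_mul_of_nonneg_right hl2 (sq_nonneg z)
    linarith
  · have hy := sq_nonneg y
    have hz := sq_nonneg z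
    have hN : 0 ≤ l * (y ^ 2 + z ^ 2) := by positivity
    have b1 := aux_bd a1 ((c * W) ^ 2) _ hXN (by nlinarith [sq_nonneg (c * W)])
    have b2 := aux_bd (a0 + a8 + a5 + a6) (c * W * y) (y ^ 2 + z ^ 2)
      (by nlinarith [sq_nonneg (c * W - y)]) (by nlinarith [sq_nonneg (c * W + y)])
    have hsz : (s * z) ^ 2 ≤ z ^ 2 := by rw [mul_pow]; nlinarith
    have q : c * s * y * z + (s ^ 2 - c ^ 2) / 2 * z ^ 2 = s * z * W - z ^ 2 / 2 := by
      rw [hW]; linear_combination (-(z ^ 2 / 2)) * hcs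
    have b3 := aux_bd (a6 - a5) (c * s * y * z + (s ^ 2 - c ^ 2) / 2 * z ^ 2)
      (2 * (y ^ 2 + z ^ 2))
      (by rw [q]; nlinarith [sq_nonneg (s * z - W)]) (by rw [q]; nlinarith [sq_nonneg (s * z + W)])
    have b4 := aux_bd ((a3 - a2 + (2 * a4 + a5 + a6)) / 4) (z ^ 2) (y ^ 2 + z ^ 2)
      (by linarith) (by linarith)
    have b5 := aux_bd (a4 + a7) (y ^ 2) (y ^ 2 + z ^ 2) (by linarith) (by linarith)
    linarith


end
end

section
/- Let α₀,α₁,…,α₈ be real Leslie coefficients with γ₁ := α₃ − α₂ > 0, γ₂ := α₆ − α₅, satisfying the Parodi relation γ₂ = α₂ + α₃. Then for every n ∈ ℝ and every y = (y₁, y₂) ∈ ℝ² the following exact sum-of-squares decomposition holds: yᵀ A(n) y = ¼ ( (γ₂/√γ₁) y₁ sin(2n) + (1/√γ₁)(γ₁ − γ₂ cos(2n)) y₂ )² + ¼ (−α₁ − γ₂²/γ₁) y₁² + (α₄ + α₇) y₁² + ¼ (2α₄ + α₅ + α₆ − γ₂²/γ₁) y₂² + ¼ (α₁ + γ₂²/γ₁)(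 y₁ cos(2n) + y₂ sin(2n) )² + (α₀ + α₁ + α₅ + α₆ + α₈)[ (y₁ cos n + ½ y₂ sin n)² − ¼ y₂² sin²n ]. -/
open Real

noncomputable section

/-- Under the Parodi relation, with `γ₁ = α₃ - α₂ > 0` and
`γ₂ = α₆ - α₅`, the quadratic form `yᵀ A(n) y` admits the exact sum-of-squares
decomposition used in the energy dissipation estimate. -/
theorem quadA_sum_of_squares
    (a0 a1 a2 a3 a4 a5 a6 a7 a8 : ℝ)
    (hγ1 : 0 < a3 - a2)
    (hParodi : a6 - a5 = a2 + a3)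
    (n y1 y2 : ℝ) :
    quadA a0 a1 a2 a3 a4 a5 a6 a7 a8 n y1 y2 =
      (1 / 4) * ((a6 - a5) / Real.sqrt (a3 - a2) * y1 * sin (2 * n)
          + (1 / Real.sqrt (a3 - a2)) * ((a3 - a2) - (a6 - a5) * cos (2 * n)) * y2) ^ 2
      + (1 / 4) * (-a1 - (a6 - a5) ^ 2 / (a3 - a2)) * y1 ^ 2
      + (a4 + a7) * y1 ^ 2
      + (1 / 4) * (2 * a4 + a5 + a6 - (a6 - a5) ^ 2 / (a3 - a2)) * y2 ^ 2
      + (1 / 4) * (a1 + (a6 - a5) ^ 2 / (a3 - a2))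
          * (y1 * cos (2 * n) + y2 * sin (2 * n)) ^ 2
      + (a0 + a1 + a5 + a6 + a8)
          * ((y1 * cos n + (1 / 2) * y2 * sin n) ^ 2
              - (1 / 4) * y2 ^ 2 * sin n ^ 2) := by
  have hr : Real.sqrt (a3 - a2) ^ 2 = a3 - a2 := Real.sq_sqrt hγ1.le
  have hr0 : Real.sqrt (a3 - a2) ≠ 0 := (Real.sqrt_pos.mpr hγ1).ne'
  have key : ∀ S C : ℝ, ((a6 - a5) / Real.sqrt (a3 - a2) * y1 * S
          + (1 / Real.sqrt (a3 - a2)) * ((a3 - a2) - (a6 - a5) * C) * y2) ^ 2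
      = (a6 - a5) ^ 2 / (a3 - a2) * (y1 * S - C * y2) ^ 2
        + 2 * (a6 - a5) * y2 * (y1 * S - C * y2) + (a3 - a2) * y2 ^ 2 := by
    intro S C
    generalize Real.sqrt (a3 - a2) = r at hr hr0
    rw [← hr]
    field_simp
    ring
  rw [key]
  generalize (a6 - a5) ^ 2 / (a3 - a2) = g
  have h6 : a6 = a5 + a2 + a3 := by linarith
  subst h6
  unfold quadA A11 A12 A21 A22
  rw [sin_two_mul, cos_two_mul]
  have hs : sin n ^ 2 = 1 - cos n ^ 2 := sin_sq n
  generalize sin n = s at hs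
  generalize cos n = c at hs
  ring_nf
  simp only [hs]
  ring

end
end

section
/- Let γ > 1 and let α₀,…,α₈ be real Leslie coefficients with γ₁ := α₃ − α₂ > 0, γ₂ := α₆ − α₅, satisfying the Parodi relation γ₂ = α₂ + α₃. Let T > 0 and let ρ, u, v, n : [0,1] × [0,T] → ℝ be smooth with ρ > 0, satisfying on (0,1)×(0,T) the one-dimensional compressible Ericksen–Leslie system: (i) ρ_t + (ρu)_x = 0; (ii) (ρu)_t + (ρu²)_x + (ρ^γ)_x = J¹ − n_{xx} n_x; (iii) (ρv)_t + (ρuv)_x = J²; (iv) γ₁(ṅ − ½ v_x) − γ₂( u_x cos n sin n + ½ v_x (1 − 2cos²n) ) = n_{xx}, where ṅ := n_t + u n_x; with boundary conditions u(0,t)=u(1,t)=v(0,t)=v(1,t)=0 and n_x(0,t)=n_x(1,t)=0. Define the energy E(t) = ½∫₀¹ ρ(u²+v²) dx + (1/(γ−1))∫₀¹ ρ^γ dx + ½∫₀¹ n_x² dx. Then for every t ∈ (0,T), dE/dt(t) = −D(t), where D(t) = ∫₀¹ [ √γ₁ ṅ − ½( (γ₂/√γ₁) u_x sin(2n) + (1/√γ₁)(γ₁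 − γ₂ cos(2n)) v_x ) ]² dx + ∫₀¹ [ ¼(−α₁ − γ₂²/γ₁) u_x² + (α₄+α₇) u_x² ] dx + ¼∫₀¹ (2α₄+α₅+α₆−γ₂²/γ₁) v_x² dx + ¼(α₁+γ₂²/γ₁) ∫₀¹ ( u_x cos(2n) + v_x sin(2n) )² dx + (α₀+α₁+α₅+α₆+α₈) ∫₀¹ [ (u_x cos n + ½ v_x sin n)² − ¼ v_x² sin²n ] dx. -/
open Set intervalIntegral Real

noncomputable section

/-- Spatial partial derivative of a function of `(x, t)`. -/
def pdx (f : ℝ → ℝ → ℝ) (x t : ℝ) : ℝ := deriv (fun y => f y t) x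

/-- Time partial derivative of a function of `(x, t)`. -/
def pdt (f : ℝ → ℝ → ℝ) (x t : ℝ) : ℝ := deriv (fun s => f x s) t

/-- The material derivative `ṅ = n_t + u n_x`. -/
def mdot (u n : ℝ → ℝ → ℝ) (x t : ℝ) : ℝ := pdt n x t + u x t * pdx n x t

/-- The second-order forcing term `J¹` in the `u`-equation of the one-dimensional
compressible Ericksen–Leslie system. -/
def J1 (a0 a1 a2 a3 a4 a5 a6 a7 a8 : ℝ) (u v n : ℝ → ℝ → ℝ) (x t : ℝ) : ℝ :=
  (a0 + a5 + a6 + a8) * pdx (fun y s => pdx u y s * cos (n y s) ^ 2) x t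
  + a1 * pdx (fun y s => pdx u y s * cos (n y s) ^ 4) x t
  - (a2 + a3) * pdx (fun y s => mdot u n y s * cos (n y s) * sin (n y s)) x t
  + (a4 + a7) * pdx (pdx u) x t
  + a0 * pdx (fun y s => pdx v y s * cos (n y s) * sin (n y s)) x t
  + a1 * pdx (fun y s => pdx v y s * cos (n y s) ^ 3 * sin (n y s)) x t
  + (1 / 2) * (a2 + a3 + a5 + a6) * pdx (fun y s => pdx v y s * cos (n y s) * sin (n y s)) x t

/-- The second-order forcing term `J²` in the `v`-equation of the one-dimensional
compressible Ericksen–Leslie system. -/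
def J2 (a1 a2 a3 a4 a5 a6 a8 : ℝ) (u v n : ℝ → ℝ → ℝ) (x t : ℝ) : ℝ :=
  a1 * pdx (fun y s => pdx u y s * cos (n y s) ^ 3 * sin (n y s)) x t
  + a2 * pdx (fun y s => mdot u n y s * cos (n y s) ^ 2) x t
  - a3 * pdx (fun y s => mdot u n y s * sin (n y s) ^ 2) x t
  + (a6 + a8) * pdx (fun y s => pdx u y s * cos (n y s) * sin (n y s)) x t
  + a1 * pdx (fun y s => pdx v y s * cos (n y s) ^ 2 * sin (n y s) ^ 2) x t
  + (1 / 2) * (-a2 + a5) * pdx (fun y s => pdx v y s * cos (n y s) ^ 2) x t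
  + (1 / 2) * (a3 + a6) * pdx (fun y s => pdx v y s * sin (n y s) ^ 2) x t
  + (1 / 2) * a4 * pdx (pdx v) x t

/-- `ELSystem γ a0 … a8 T ρ u v n` says that `(ρ, u, v, n)` is a smooth solution, with
positive density, of the one-dimensional compressible Ericksen–Leslie system on
`[0,1] × [0,T]`, with the homogeneous boundary conditions
`u = v = 0`, `n_x = 0` at `x = 0, 1`. -/
def ELSystem (γ a0 a1 a2 a3 a4 a5 a6 a7 a8 T : ℝ) (ρ u v n : ℝ → ℝ → ℝ) : Prop :=
  ContDiff ℝ (⊤ : ℕ∞) (fun p : ℝ × ℝ => ρ p.1 p.2) ∧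
  ContDiff ℝ (⊤ : ℕ∞) (fun p : ℝ × ℝ => u p.1 p.2) ∧
  ContDiff ℝ (⊤ : ℕ∞) (fun p : ℝ × ℝ => v p.1 p.2) ∧
  ContDiff ℝ (⊤ : ℕ∞) (fun p : ℝ × ℝ => n p.1 p.2) ∧
  (∀ x ∈ Icc (0:ℝ) 1, ∀ t ∈ Icc (0:ℝ) T, 0 < ρ x t) ∧
  (∀ x ∈ Ioo (0:ℝ) 1, ∀ t ∈ Ioo (0:ℝ) T,
    pdt ρ x t + pdx (fun y s => ρ y s * u y s) x t = 0 ∧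
    pdt (fun y s => ρ y s * u y s) x t + pdx (fun y s => ρ y s * u y s ^ 2) x t
        + pdx (fun y s => ρ y s ^ γ) x t
      = J1 a0 a1 a2 a3 a4 a5 a6 a7 a8 u v n x t - pdx (pdx n) x t * pdx n x t ∧
    pdt (fun y s => ρ y s * v y s) x t + pdx (fun y s => ρ y s * u y s * v y s) x t
      = J2 a1 a2 a3 a4 a5 a6 a8 u v n x t ∧
    (a3 - a2) * (mdot u n x t - (1 / 2) * pdx v x t)
        - (a6 - a5) * (pdx u x t * cos (n x t) * sin (n x t)
            + (1 / 2) * pdx v x t * (1 - 2 * cos (n x t) ^ 2))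
      = pdx (pdx n) x t) ∧
  (∀ t ∈ Icc (0:ℝ) T,
    u 0 t = 0 ∧ u 1 t = 0 ∧ v 0 t = 0 ∧ v 1 t = 0 ∧ pdx n 0 t = 0 ∧ pdx n 1 t = 0)

/-- The total energy `E(t)` of the one-dimensional compressible Ericksen–Leslie
system. -/
def energy (γ : ℝ) (ρ u v n : ℝ → ℝ → ℝ) (t : ℝ) : ℝ :=
  (1 / 2) * (∫ x in (0:ℝ)..1, ρ x t * ((u x t) ^ 2 + (v x t) ^ 2))
  + (1 / (γ - 1)) * (∫ x in (0:ℝ)..1, ρ x t ^ γ)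
  + (1 / 2) * (∫ x in (0:ℝ)..1, (pdx n x t) ^ 2)

/-- The dissipation functional `D(t)` of the one-dimensional compressible
Ericksen–Leslie system, with `γ₁ = a3 - a2` and `γ₂ = a6 - a5`. -/
def dissip (a0 a1 a2 a3 a4 a5 a6 a7 a8 : ℝ) (u v n : ℝ → ℝ → ℝ) (t : ℝ) : ℝ :=
  (∫ x in (0:ℝ)..1,
      (Real.sqrt (a3 - a2) * mdot u n x t
        - (1 / 2) * (((a6 - a5) / Real.sqrt (a3 - a2)) * pdx u x t * sin (2 * n x t)
            + (1 / Real.sqrt (a3 - a2)) * ((a3 - a2) - (a6 - a5) * cos (2 * n x t))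
              * pdx v x t)) ^ 2)
  + (∫ x in (0:ℝ)..1,
      ((1 / 4) * (-a1 - (a6 - a5) ^ 2 / (a3 - a2)) * (pdx u x t) ^ 2
        + (a4 + a7) * (pdx u x t) ^ 2))
  + (1 / 4) * (∫ x in (0:ℝ)..1,
      (2 * a4 + a5 + a6 - (a6 - a5) ^ 2 / (a3 - a2)) * (pdx v x t) ^ 2)
  + (1 / 4) * (a1 + (a6 - a5) ^ 2 / (a3 - a2)) * (∫ x in (0:ℝ)..1,
      (pdx u x t * cos (2 * n x t) + pdx v x t * sin (2 * n x t)) ^ 2)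
  + (a0 + a1 + a5 + a6 + a8) * (∫ x in (0:ℝ)..1,
      ((pdx u x t * cos (n x t) + (1 / 2) * pdx v x t * sin (n x t)) ^ 2
        - (1 / 4) * (pdx v x t) ^ 2 * sin (n x t) ^ 2))

lemma alg (q a0 a1 a2 a3 a4 a5 a6 a7 a8 c s N ux vx nxx : ℝ) (hq : q ≠ 0) (hq2 : q ^ 2 = a3 - a2)
   (hP : a6 - a5 = a2 + a3) (hcs : s ^ 2 = 1 - c ^ 2)
   (h4 : (a3 - a2) * (N - (1 / 2) * vx)
        - (a6 - a5) * (ux * c * s + (1 / 2) * vx * (1 - 2 * c ^ 2)) = nxx) :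
   (q * N - (1 / 2) * (((a6 - a5) / q) * ux * (2 * s * c)
            + (1 / q) * ((a3 - a2) - (a6 - a5) * (2 * c ^ 2 - 1)) * vx)) ^ 2
   + ((1 / 4) * (-a1 - (a6 - a5) ^ 2 / (a3 - a2)) * ux ^ 2 + (a4 + a7) * ux ^ 2)
   + (1 / 4) * ((2 * a4 + a5 + a6 - (a6 - a5) ^ 2 / (a3 - a2)) * vx ^ 2)
   + (1 / 4) * (a1 + (a6 - a5) ^ 2 / (a3 - a2)) *
      (ux * (2 * c ^ 2 - 1) + vx * (2 * s * c)) ^ 2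
   + (a0 + a1 + a5 + a6 + a8) * ((ux * c + (1 / 2) * vx * s) ^ 2 - (1 / 4) * vx ^ 2 * s ^ 2)
   = nxx * N + ux * ((a0 + a5 + a6 + a8) * (ux * c ^ 2) + a1 * (ux * c ^ 4)
      - (a2 + a3) * (N * c * s) + (a4 + a7) * ux + a0 * (vx * c * s) + a1 * (vx * c ^ 3 * s)
      + (1 / 2) * (a2 + a3 + a5 + a6) * (vx * c * s))
     + vx * (a1 * (ux * c ^ 3 * s) + a2 * (N * c ^ 2) - a3 * (N * s ^ 2)
       + (a6 + a8) * (ux * c * s) + a1 * (vx * c ^ 2 * s ^ 2) + (1 / 2) * (-a2 + a5) * (vx * c ^ 2)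
       + (1 / 2) * (a3 + a6) * (vx * s ^ 2) + (1 / 2) * a4 * vx) := by
  subst h4
  obtain rfl : a3 = q ^ 2 + a2 := by linarith
  obtain rfl : a6 = 2 * a2 + q ^ 2 + a5 := by linarith
  have e : q ^ 2 + a2 - a2 = q ^ 2 := by ring
  rw [e]
  field_simp
  ring_nf
  simp only [hcs]
  ring

lemma leib (F F' : ℝ → ℝ → ℝ) (hF : Continuous (fun p : ℝ × ℝ => F p.1 p.2))
    (hF' : Continuous (fun p : ℝ × ℝ => F' p.1 p.2))
    (hd : ∀ x t, HasDerivAt (fun s => F x s) (F' x t) t) (t : ℝ) :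
    HasDerivAt (fun s => ∫ x in (0:ℝ)..1, F x s) (∫ x in (0:ℝ)..1, F' x t) t := by
  obtain ⟨C, hC⟩ := ((isCompact_Icc (a := (0:ℝ)) (b := 1)).prod
    (isCompact_closedBall t 1)).exists_bound_of_continuousOn hF'.continuousOn
  refine (intervalIntegral.hasDerivAt_integral_of_dominated_loc_of_deriv_le
    (F := fun s x => F x s) (F' := fun s x => F' x s)
    (s := Metric.ball t 1) (bound := fun _ => C) (Metric.ball_mem_nhds t one_pos) ?_ ?_ ?_ ?_ ?_ ?_).2
  · refine Filter.Eventually.of_forall fun s => ?_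
    exact (hF.comp (by fun_prop : Continuous fun x : ℝ => (x, s))).aestronglyMeasurable
  · exact (hF.comp (by fun_prop : Continuous fun x : ℝ => (x, t))).intervalIntegrable _ _
  · exact (hF'.comp (by fun_prop : Continuous fun x : ℝ => (x, t))).aestronglyMeasurable
  · refine Filter.Eventually.of_forall fun x hx s hs => ?_
    rw [uIoc_of_le zero_le_one] at hx
    exact hC (x, s) ⟨⟨hx.1.le, hx.2⟩, Metric.ball_subset_closedBall hs⟩
  · simp
  · exact Filter.Eventually.of_forall fun x hx s hs => hd x s

abbrev Sm (f : ℝ → ℝ → ℝ) : Prop := ContDiff ℝ (⊤ : ℕ∞) (fun p : ℝ × ℝ => f p.1 p.2)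

lemma sm_hx {f : ℝ → ℝ → ℝ} (hf : Sm f) (x t : ℝ) :
    HasDerivAt (fun y => f y t) (fderiv ℝ (fun p : ℝ × ℝ => f p.1 p.2) (x, t) (1, 0)) x := by
  have h := (hf.differentiable (by simp) (x, t)).hasFDerivAt
  have h2 : HasDerivAt (fun y : ℝ => (y, t)) ((1:ℝ), (0:ℝ)) x :=
    (hasDerivAt_id x).prodMk (hasDerivAt_const x t)
  exact h.comp_hasDerivAt x h2

lemma sm_ht {f : ℝ → ℝ → ℝ} (hf : Sm f) (x t : ℝ) :
    HasDerivAt (fun s => f x s) (fderiv ℝ (fun p : ℝ × ℝ => f p.1 p.2) (x, t) (0, 1)) t := by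
  have h := (hf.differentiable (by simp) (x, t)).hasFDerivAt
  have h2 : HasDerivAt (fun s : ℝ => (x, s)) ((0:ℝ), (1:ℝ)) t :=
    (hasDerivAt_const t x).prodMk (hasDerivAt_id t)
  exact h.comp_hasDerivAt t h2

lemma sm_dx {f : ℝ → ℝ → ℝ} (hf : Sm f) (x t : ℝ) :
    HasDerivAt (fun y => f y t) (pdx f x t) x := (sm_hx hf x t).differentiableAt.hasDerivAt

lemma sm_dt {f : ℝ → ℝ → ℝ} (hf : Sm f) (x t : ℝ) :
    HasDerivAt (fun s => f x s) (pdt f x t) t := (sm_ht hf x t).differentiableAt.hasDerivAt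

lemma sm_pdx {f : ℝ → ℝ → ℝ} (hf : Sm f) : Sm (pdx f) := by
  have : (fun p : ℝ × ℝ => pdx f p.1 p.2) =
      fun p => fderiv ℝ (fun p : ℝ × ℝ => f p.1 p.2) p (1, 0) := by
    ext p; exact (sm_hx hf p.1 p.2).deriv
  unfold Sm
  rw [this]
  exact (hf.fderiv_right (m := (⊤ : ℕ∞)) (by simp)).clm_apply contDiff_const

lemma sm_pdt {f : ℝ → ℝ → ℝ} (hf : Sm f) : Sm (pdt f) := by
  have : (fun p : ℝ × ℝ => pdt f p.1 p.2) =
      fun p => fderiv ℝ (fun p : ℝ × ℝ => f p.1 p.2) p (0, 1) := by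
    ext p; exact (sm_ht hf p.1 p.2).deriv
  unfold Sm
  rw [this]
  exact (hf.fderiv_right (m := (⊤ : ℕ∞)) (by simp)).clm_apply contDiff_const

lemma sm_comm {f : ℝ → ℝ → ℝ} (hf : Sm f) (x t : ℝ) : pdx (pdt f) x t = pdt (pdx f) x t := by
  have hx : (fun p : ℝ × ℝ => pdx f p.1 p.2) =
      fun p => fderiv ℝ (fun p : ℝ × ℝ => f p.1 p.2) p (1, 0) := by
    ext p; exact (sm_hx hf p.1 p.2).deriv
  have ht : (fun p : ℝ × ℝ => pdt f p.1 p.2) =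
      fun p => fderiv ℝ (fun p : ℝ × ℝ => f p.1 p.2) p (0, 1) := by
    ext p; exact (sm_ht hf p.1 p.2).deriv
  have hd : DifferentiableAt ℝ (fderiv ℝ (fun p : ℝ × ℝ => f p.1 p.2)) (x, t) :=
    (hf.fderiv_right (m := (⊤ : ℕ∞)) (by simp)).differentiable (by simp) _
  have e1 : pdx (pdt f) x t = _ := (sm_hx (sm_pdt hf) x t).deriv
  have e2 : pdt (pdx f) x t = _ := (sm_ht (sm_pdx hf) x t).deriv
  rw [e1, e2, hx, ht, fderiv_clm_apply hd (by fun_prop), fderiv_clm_apply hd (by fun_prop)]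
  simp
  have hs : IsSymmSndFDerivAt ℝ (fun p : ℝ × ℝ => f p.1 p.2) (x, t) :=
    hf.contDiffAt.isSymmSndFDerivAt (by
      simp only [minSmoothness_of_isRCLikeNormedField]
      exact WithTop.coe_le_coe.2 (le_top : (2:ℕ∞) ≤ ⊤))
  exact hs _ _

lemma sm_mdot {u n : ℝ → ℝ → ℝ} (hu : Sm u) (hn : Sm n) : Sm (mdot u n) := by
  have h1 := sm_pdt hn
  have h2 := sm_pdx hn
  unfold Sm mdot at *
  fun_prop

def F1 (a0 a1 a2 a3 a4 a5 a6 a7 a8 : ℝ) (u v n : ℝ → ℝ → ℝ) (x t : ℝ) : ℝ :=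
  (a0 + a5 + a6 + a8) * (pdx u x t * cos (n x t) ^ 2)
  + a1 * (pdx u x t * cos (n x t) ^ 4)
  - (a2 + a3) * (mdot u n x t * cos (n x t) * sin (n x t))
  + (a4 + a7) * pdx u x t
  + a0 * (pdx v x t * cos (n x t) * sin (n x t))
  + a1 * (pdx v x t * cos (n x t) ^ 3 * sin (n x t))
  + (1 / 2) * (a2 + a3 + a5 + a6) * (pdx v x t * cos (n x t) * sin (n x t))

def F2 (a1 a2 a3 a4 a5 a6 a8 : ℝ) (u v n : ℝ → ℝ → ℝ) (x t : ℝ) : ℝ :=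
  a1 * (pdx u x t * cos (n x t) ^ 3 * sin (n x t))
  + a2 * (mdot u n x t * cos (n x t) ^ 2)
  - a3 * (mdot u n x t * sin (n x t) ^ 2)
  + (a6 + a8) * (pdx u x t * cos (n x t) * sin (n x t))
  + a1 * (pdx v x t * cos (n x t) ^ 2 * sin (n x t) ^ 2)
  + (1 / 2) * (-a2 + a5) * (pdx v x t * cos (n x t) ^ 2)
  + (1 / 2) * (a3 + a6) * (pdx v x t * sin (n x t) ^ 2)
  + (1 / 2) * a4 * pdx v x t

lemma sm_F1 (a0 a1 a2 a3 a4 a5 a6 a7 a8 : ℝ) {u v n : ℝ → ℝ → ℝ} (hu : Sm u) (hv : Sm v)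
    (hn : Sm n) : Sm (F1 a0 a1 a2 a3 a4 a5 a6 a7 a8 u v n) := by
  have h1 := sm_pdx hu
  have h2 := sm_pdx hv
  have h3 := sm_mdot hu hn
  unfold Sm F1 at *
  fun_prop

lemma sm_F2 (a1 a2 a3 a4 a5 a6 a8 : ℝ) {u v n : ℝ → ℝ → ℝ} (hu : Sm u) (hv : Sm v)
    (hn : Sm n) : Sm (F2 a1 a2 a3 a4 a5 a6 a8 u v n) := by
  have h1 := sm_pdx hu
  have h2 := sm_pdx hv
  have h3 := sm_mdot hu hn
  unfold Sm F2 at *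
  fun_prop

lemma F1_dx (a0 a1 a2 a3 a4 a5 a6 a7 a8 : ℝ) {u v n : ℝ → ℝ → ℝ} (hu : Sm u) (hv : Sm v)
    (hn : Sm n) (x t : ℝ) : HasDerivAt (fun y => F1 a0 a1 a2 a3 a4 a5 a6 a7 a8 u v n y t)
      (J1 a0 a1 a2 a3 a4 a5 a6 a7 a8 u v n x t) x := by
  have h1 := sm_pdx hu
  have h2 := sm_pdx hv
  have h3 := sm_mdot hu hn
  unfold F1 J1
  refine HasDerivAt.add (HasDerivAt.add (HasDerivAt.add (HasDerivAt.add (HasDerivAt.sub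
    (HasDerivAt.add ?_ ?_) ?_) ?_) ?_) ?_) ?_
  all_goals refine HasDerivAt.const_mul _ ?_
  · exact sm_dx (f := fun y s => pdx u y s * cos (n y s) ^ 2) (by unfold Sm at *; fun_prop) x t
  · exact sm_dx (f := fun y s => pdx u y s * cos (n y s) ^ 4) (by unfold Sm at *; fun_prop) x t
  · exact sm_dx (f := fun y s => mdot u n y s * cos (n y s) * sin (n y s))
      (by unfold Sm at *; fun_prop) x t
  · exact sm_dx h1 x t
  · exact sm_dx (f := fun y s => pdx v y s * cos (n y s) * sin (n y s))
      (by unfold Sm at *; fun_prop) x t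
  · exact sm_dx (f := fun y s => pdx v y s * cos (n y s) ^ 3 * sin (n y s))
      (by unfold Sm at *; fun_prop) x t
  · exact sm_dx (f := fun y s => pdx v y s * cos (n y s) * sin (n y s))
      (by unfold Sm at *; fun_prop) x t

lemma F2_dx (a1 a2 a3 a4 a5 a6 a8 : ℝ) {u v n : ℝ → ℝ → ℝ} (hu : Sm u) (hv : Sm v)
    (hn : Sm n) (x t : ℝ) : HasDerivAt (fun y => F2 a1 a2 a3 a4 a5 a6 a8 u v n y t)
      (J2 a1 a2 a3 a4 a5 a6 a8 u v n x t) x := by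
  have h1 := sm_pdx hu
  have h2 := sm_pdx hv
  have h3 := sm_mdot hu hn
  unfold F2 J2
  refine HasDerivAt.add (HasDerivAt.add (HasDerivAt.add (HasDerivAt.add (HasDerivAt.add
    (HasDerivAt.sub (HasDerivAt.add ?_ ?_) ?_) ?_) ?_) ?_) ?_) ?_
  all_goals refine HasDerivAt.const_mul _ ?_
  · exact sm_dx (f := fun y s => pdx u y s * cos (n y s) ^ 3 * sin (n y s))
      (by unfold Sm at *; fun_prop) x t
  · exact sm_dx (f := fun y s => mdot u n y s * cos (n y s) ^ 2)
      (by unfold Sm at *; fun_prop) x t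
  · exact sm_dx (f := fun y s => mdot u n y s * sin (n y s) ^ 2)
      (by unfold Sm at *; fun_prop) x t
  · exact sm_dx (f := fun y s => pdx u y s * cos (n y s) * sin (n y s))
      (by unfold Sm at *; fun_prop) x t
  · exact sm_dx (f := fun y s => pdx v y s * cos (n y s) ^ 2 * sin (n y s) ^ 2)
      (by unfold Sm at *; fun_prop) x t
  · exact sm_dx (f := fun y s => pdx v y s * cos (n y s) ^ 2) (by unfold Sm at *; fun_prop) x t
  · exact sm_dx (f := fun y s => pdx v y s * sin (n y s) ^ 2) (by unfold Sm at *; fun_prop) x t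
  · exact sm_dx h2 x t

/-- For any smooth positive-density solution of the one-dimensional
compressible Ericksen–Leslie system on `[0,1] × [0,T]`, under `γ > 1`, `γ₁ > 0` and
the Parodi relation `γ₂ = α₂ + α₃`, the energy satisfies `dE/dt (t) = -D(t)` for all
`t ∈ (0,T)`. -/
theorem energy_dissipation_identity
    (γ a0 a1 a2 a3 a4 a5 a6 a7 a8 T : ℝ)
    (hγ : 1 < γ) (hγ1 : 0 < a3 - a2) (hParodi : a6 - a5 = a2 + a3) (hT : 0 < T)
    (ρ u v n : ℝ → ℝ → ℝ)
    (hsol : ELSystem γ a0 a1 a2 a3 a4 a5 a6 a7 a8 T ρ u v n) :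
    ∀ t ∈ Ioo (0:ℝ) T,
      HasDerivAt (energy γ ρ u v n) (-(dissip a0 a1 a2 a3 a4 a5 a6 a7 a8 u v n t)) t := by
  intro t ht
  obtain ⟨hρ, hu, hv, hn, hpos, heq, hbc⟩ := hsol
  change Sm ρ at hρ
  change Sm u at hu
  change Sm v at hv
  change Sm n at hn
  have hux := sm_pdx hu
  have hvx := sm_pdx hv
  have hnx := sm_pdx hn
  have hnt := sm_pdt hn
  have hN := sm_mdot hu hn
  have hρt := sm_pdt hρ
  have hut := sm_pdt hu
  have hvt := sm_pdt hv
  have hnxt := sm_pdt hnx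
  have hnxx := sm_pdx hnx
  have hρx := sm_pdx hρ
  have cpow : ∀ r : ℝ, 0 ≤ r → Continuous (fun p : ℝ × ℝ => ρ p.1 p.2 ^ r) := fun r hr =>
    hρ.continuous.rpow_const (fun _ => Or.inr hr)
  have cγ := cpow γ (by linarith)
  have cγ1 := cpow (γ - 1) (by linarith)
  have E1 := leib (fun x s => ρ x s * ((u x s) ^ 2 + (v x s) ^ 2))
    (fun x s => pdt ρ x s * ((u x s) ^ 2 + (v x s) ^ 2)
      + ρ x s * (2 * u x s * pdt u x s + 2 * v x s * pdt v x s))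
    (by have := hρ.continuous; have := hu.continuous; have := hv.continuous; fun_prop)
    (by have := hρ.continuous; have := hu.continuous; have := hv.continuous
        have := hρt.continuous; have := hut.continuous; have := hvt.continuous; fun_prop)
    (fun x s => by
      have := (sm_dt hρ x s).mul (((sm_dt hu x s).pow 2).add ((sm_dt hv x s).pow 2))
      refine this.congr_deriv ?_
      simp) t
  have E2 := leib (fun x s => ρ x s ^ γ)
    (fun x s => pdt ρ x s * γ * ρ x s ^ (γ - 1))
    cγ (by have := hρt.continuous; fun_prop)
    (fun x s => (sm_dt hρ x s).rpow_const (Or.inr hγ.le)) t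
  have E3 := leib (fun x s => (pdx n x s) ^ 2)
    (fun x s => 2 * pdx n x s * pdt (pdx n) x s)
    (by have := hnx.continuous; fun_prop)
    (by have := hnx.continuous; have := hnxt.continuous; fun_prop)
    (fun x s => by
      refine ((sm_dt hnx x s).pow 2).congr_deriv ?_
      simp) t
  have E := ((E1.const_mul (1/2)).add (E2.const_mul (1/(γ-1)))).add (E3.const_mul (1/2))
  refine HasDerivAt.congr_deriv (f' := _) E ?_
  -- space-only continuity facts
  have sl : ∀ {f : ℝ → ℝ → ℝ}, Continuous (fun p : ℝ × ℝ => f p.1 p.2) →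
      Continuous (fun x => f x t) := fun {f} hf =>
    hf.comp (by fun_prop : Continuous fun x : ℝ => (x, t))
  have k1 := sl hρ.continuous
  have k2 := sl hu.continuous
  have k3 := sl hv.continuous
  have k4 := sl hn.continuous
  have k5 := sl hux.continuous
  have k6 := sl hvx.continuous
  have k7 := sl hnx.continuous
  have k8 := sl hnt.continuous
  have k9 := sl hN.continuous
  have k10 := sl hρt.continuous
  have k11 := sl hut.continuous
  have k12 := sl hvt.continuous
  have k13 := sl hnxt.continuous
  have k14 := sl hnxx.continuous
  have k15 := sl hρx.continuous
  have k16 := sl (f := fun x t => ρ x t ^ γ) cγ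
  have k17 := sl (f := fun x t => ρ x t ^ (γ - 1)) cγ1
  have k18 := sl (sm_F1 a0 a1 a2 a3 a4 a5 a6 a7 a8 hu hv hn).continuous
  have k19 := sl (sm_F2 a1 a2 a3 a4 a5 a6 a8 hu hv hn).continuous
  have k20 : Continuous (fun x => J1 a0 a1 a2 a3 a4 a5 a6 a7 a8 u v n x t) := by
    have := sl (sm_pdx (sm_F1 a0 a1 a2 a3 a4 a5 a6 a7 a8 hu hv hn)).continuous
    convert this using 2 with x
    exact (F1_dx a0 a1 a2 a3 a4 a5 a6 a7 a8 hu hv hn x t).deriv.symm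
  have k21 : Continuous (fun x => J2 a1 a2 a3 a4 a5 a6 a8 u v n x t) := by
    have := sl (sm_pdx (sm_F2 a1 a2 a3 a4 a5 a6 a8 hu hv hn)).continuous
    convert this using 2 with x
    exact (F2_dx a1 a2 a3 a4 a5 a6 a8 hu hv hn x t).deriv.symm
  -- flux
  have hG : ∀ x, HasDerivAt (fun x => -(1/2) * (ρ x t * u x t * ((u x t)^2 + (v x t)^2))
      - γ / (γ-1) * (ρ x t ^ γ * u x t) + u x t * F1 a0 a1 a2 a3 a4 a5 a6 a7 a8 u v n x t
      + v x t * F2 a1 a2 a3 a4 a5 a6 a8 u v n x t + pdx n x t * pdt n x t)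
      (-(1/2) * ((pdx ρ x t * u x t + ρ x t * pdx u x t) * ((u x t)^2 + (v x t)^2)
        + ρ x t * u x t * (2 * u x t * pdx u x t + 2 * v x t * pdx v x t))
      - γ / (γ-1) * (pdx ρ x t * γ * ρ x t ^ (γ - 1) * u x t + ρ x t ^ γ * pdx u x t)
      + (pdx u x t * F1 a0 a1 a2 a3 a4 a5 a6 a7 a8 u v n x t
        + u x t * J1 a0 a1 a2 a3 a4 a5 a6 a7 a8 u v n x t)
      + (pdx v x t * F2 a1 a2 a3 a4 a5 a6 a8 u v n x t
        + v x t * J2 a1 a2 a3 a4 a5 a6 a8 u v n x t)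
      + (pdx (pdx n) x t * pdt n x t + pdx n x t * pdt (pdx n) x t)) x := by
    intro x
    have d1 := sm_dx hρ x t
    have d2 := sm_dx hu x t
    have d3 := sm_dx hv x t
    have d4 := F1_dx a0 a1 a2 a3 a4 a5 a6 a7 a8 hu hv hn x t
    have d5 := F2_dx a1 a2 a3 a4 a5 a6 a8 hu hv hn x t
    have d6 := sm_dx hnx x t
    have d7 := sm_dx hnt x t
    rw [sm_comm hn] at d7
    have d8 := d1.rpow_const (p := γ) (Or.inr hγ.le)
    refine ((((((d1.mul d2).mul ((d2.pow 2).add (d3.pow 2))).const_mul (-(1/2))).sub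
      ((d8.mul d2).const_mul (γ/(γ-1)))).add (d2.mul d4)).add (d3.mul d5)).add
      (d6.mul d7) |>.congr_deriv ?_
    simp
  have hI := intervalIntegral.integral_eq_sub_of_hasDerivAt (a := 0) (b := 1)
    (fun x _ => hG x) (Continuous.intervalIntegrable (by fun_prop) _ _)
  obtain ⟨b1, b2, b3, b4, b5, b6⟩ := hbc t ⟨ht.1.le, ht.2.le⟩
  rw [b1, b2, b3, b4, b5, b6] at hI
  unfold dissip
  rw [eq_neg_iff_add_eq_zero]
  simp only [← intervalIntegral.integral_const_mul]
  have cs : ∀ y, sin (2 * y) = 2 * sin y * cos y := Real.sin_two_mul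
  have cc : ∀ y, cos (2 * y) = 2 * cos y ^ 2 - 1 := Real.cos_two_mul
  simp only [cs, cc]
  rw [← intervalIntegral.integral_add, ← intervalIntegral.integral_add,
    ← intervalIntegral.integral_add, ← intervalIntegral.integral_add,
    ← intervalIntegral.integral_add, ← intervalIntegral.integral_add,
    ← intervalIntegral.integral_add]
  · refine Eq.trans (Eq.trans ?_ hI) (by ring)
    refine intervalIntegral.integral_congr_Ioo_of_le zero_le_one ?_
    intro x hx
    obtain ⟨e1, e2, e3, e4⟩ := heq x hx t ht
    have hr := hpos x ⟨hx.1.le, hx.2.le⟩ t ⟨ht.1.le, ht.2.le⟩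
    have d1 := sm_dx hρ x t
    have d2 := sm_dx hu x t
    have d3 := sm_dx hv x t
    have t1 := sm_dt hρ x t
    have t2 := sm_dt hu x t
    have t3 := sm_dt hv x t
    have p1 : pdx (fun y s => ρ y s * u y s) x t = _ := (d1.mul d2).deriv
    have p2 : pdx (fun y s => ρ y s * u y s ^ 2) x t = _ := (d1.mul (d2.pow 2)).deriv
    have p3 : pdx (fun y s => ρ y s ^ γ) x t = _ := (d1.rpow_const (p := γ) (Or.inr hγ.le)).deriv
    have p4 : pdx (fun y s => ρ y s * u y s * v y s) x t = _ := ((d1.mul d2).mul d3).deriv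
    have p5 : pdt (fun y s => ρ y s * u y s) x t = _ := (t1.mul t2).deriv
    have p6 : pdt (fun y s => ρ y s * v y s) x t = _ := (t1.mul t3).deriv
    rw [p1] at e1
    rw [p5, p2, p3] at e2
    rw [p6, p4] at e3
    have A := alg (Real.sqrt (a3 - a2)) a0 a1 a2 a3 a4 a5 a6 a7 a8 (cos (n x t)) (sin (n x t))
      (mdot u n x t) (pdx u x t) (pdx v x t) (pdx (pdx n) x t) (Real.sqrt_pos.2 hγ1).ne'
      (Real.sq_sqrt hγ1.le) hParodi (Real.sin_sq _) e4
    have hp : ρ x t ^ γ = ρ x t ^ (γ - 1) * ρ x t := by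
      rw [← Real.rpow_add_one hr.ne']; ring_nf
    have hm : mdot u n x t = pdt n x t + u x t * pdx n x t := rfl
    have hk : (γ - 1)⁻¹ * (γ - 1) = 1 := inv_mul_cancel₀ (by linarith)
    beta_reduce
    unfold F1 F2
    simp only [Pi.mul_apply, Pi.pow_apply, Nat.cast_ofNat, Nat.add_one_sub_one, pow_one] at e1 e2 e3
    linear_combination A + (γ / (γ - 1) * ρ x t ^ (γ - 1) - (1/2) * (u x t ^ 2 + v x t ^ 2)) * e1
      + u x t * e2 + v x t * e3 + pdx (pdx n) x t * hm
      + γ * ρ x t ^ (γ - 1) * pdx ρ x t * u x t * hk + γ / (γ - 1) * pdx u x t * hp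
  all_goals exact Continuous.intervalIntegrable (by fun_prop) _ _

end
end

section
/- Let ρ : [0,1] → ℝ be continuously differentiable with ρ > 0 and ∫₀¹ ρ(x) dx = 1. Then sup_{x ∈ [0,1]} 1/ρ(x) ≤ 2 + ∫₀¹ ρ(x) ( (1/ρ)'(x) )² dx, where (1/ρ)' denotes the derivative of the function x ↦ 1/ρ(x). -/
open Set intervalIntegral

/-- If `ρ` is continuously differentiable on `[0,1]` with `ρ > 0`
and `∫₀¹ ρ = 1`, then `sup_{[0,1]} 1/ρ ≤ 2 + ∫₀¹ ρ ((1/ρ)')²`.  Here `g'` is the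
(continuous) derivative of `x ↦ 1/ρ(x)` on `[0,1]`. -/
theorem inv_density_pointwise_bound
    (ρ g' : ℝ → ℝ)
    (hρC1 : ContDiffOn ℝ 1 ρ (Icc 0 1))
    (hρpos : ∀ x ∈ Icc (0:ℝ) 1, 0 < ρ x)
    (hg' : ∀ x ∈ Icc (0:ℝ) 1, HasDerivWithinAt (fun y => 1 / ρ y) (g' x) (Icc 0 1) x)
    (hg'cont : ContinuousOn g' (Icc 0 1))
    (hmass : (∫ x in (0:ℝ)..1, ρ x) = 1) :
    ∀ x ∈ Icc (0:ℝ) 1, 1 / ρ x ≤ 2 + ∫ x in (0:ℝ)..1, ρ x * (g' x) ^ 2 := by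
  have hρc : ContinuousOn ρ (Icc 0 1) := hρC1.continuousOn
  have hvc : ContinuousOn (fun y => 1 / ρ y) (Icc 0 1) :=
    fun x hx => (hg' x hx).continuousWithinAt
  obtain ⟨x0, hx0, h1⟩ : ∃ x0 ∈ Icc (0:ℝ) 1, 1 ≤ ρ x0 := by
    by_contra hcon
    push Not at hcon
    have := intervalIntegral.integral_lt_integral_of_continuousOn_of_le_of_exists_lt
      (a := (0:ℝ)) (b := 1) (f := ρ) (g := fun _ => 1) one_pos hρc continuousOn_const
      (fun x hx => (hcon x (Ioc_subset_Icc_self hx)).le) ⟨0, by simp, hcon 0 (by simp)⟩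
    rw [hmass] at this
    simp at this
  obtain ⟨m, hm, hmax⟩ := isCompact_Icc.exists_isMaxOn (nonempty_Icc.2 (zero_le_one (α := ℝ))) hvc
  have hsub : uIcc x0 m ⊆ Icc 0 1 := uIcc_subset_Icc hx0 hm
  have hFTC : ∫ x in x0..m, g' x = 1 / ρ m - 1 / ρ x0 := by
    refine intervalIntegral.integral_eq_sub_of_hasDeriv_right (f := fun y => 1 / ρ y)
      (hvc.mono hsub) ?_ (hg'cont.mono hsub).intervalIntegrable
    intro x hx
    have h0 : 0 < x := lt_of_le_of_lt (le_min hx0.1 hm.1) hx.1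
    have h2 : x < 1 := lt_of_lt_of_le hx.2 (max_le hx0.2 hm.2)
    exact ((hg' x ⟨h0.le, h2.le⟩).hasDerivAt (Icc_mem_nhds h0 h2)).hasDerivWithinAt
  set V := 1 / ρ m with hV
  have hρg : ContinuousOn (fun x => ρ x * (g' x) ^ 2) (Icc 0 1) := hρc.mul (hg'cont.pow 2)
  have hhc : ContinuousOn (fun x => (ρ x * (g' x) ^ 2 + V) / 2) (Icc 0 1) :=
    (hρg.add continuousOn_const).div_const 2
  have hpt : ∀ x ∈ Icc (0:ℝ) 1, ‖g' x‖ ≤ (ρ x * (g' x) ^ 2 + V) / 2 := by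
    intro x hx
    have hr := hρpos x hx
    have hle : 1 / ρ x ≤ V := hmax hx
    rw [Real.norm_eq_abs]
    have key : 2 * |g' x| ≤ ρ x * (g' x) ^ 2 + 1 / ρ x := by
      have e : ρ x * (g' x) ^ 2 + 1 / ρ x - 2 * |g' x| = (ρ x * |g' x| - 1) ^ 2 / ρ x := by
        rw [← sq_abs (g' x)]
        field_simp
        ring
      have : 0 ≤ (ρ x * |g' x| - 1) ^ 2 / ρ x := by positivity
      linarith
    linarith
  have hsub2 : uIoc x0 m ⊆ Ioc 0 1 := by
    intro x hx
    exact ⟨lt_of_le_of_lt (le_min hx0.1 hm.1) hx.1, hx.2.trans (max_le hx0.2 hm.2)⟩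
  have hgi : MeasureTheory.IntegrableOn (fun x => ‖g' x‖) (Ioc 0 1) :=
    (hg'cont.norm.integrableOn_Icc).mono_set Ioc_subset_Icc_self
  have hhi : MeasureTheory.IntegrableOn (fun x => (ρ x * (g' x) ^ 2 + V) / 2) (Ioc 0 1) :=
    (hhc.integrableOn_Icc).mono_set Ioc_subset_Icc_self
  have hB : ‖∫ x in x0..m, g' x‖ ≤ ∫ x in (0:ℝ)..1, (ρ x * (g' x) ^ 2 + V) / 2 := by
    rw [intervalIntegral.integral_of_le zero_le_one]
    refine (intervalIntegral.norm_integral_le_integral_norm_uIoc).trans ?_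
    refine (MeasureTheory.setIntegral_mono_set hgi
      (Filter.Eventually.of_forall fun x => norm_nonneg _) hsub2.eventuallyLE).trans ?_
    exact MeasureTheory.setIntegral_mono_on hgi hhi measurableSet_Ioc
      (fun x hx => hpt x (Ioc_subset_Icc_self hx))
  have hint : IntervalIntegrable (fun x => ρ x * (g' x) ^ 2) MeasureTheory.volume 0 1 :=
    ContinuousOn.intervalIntegrable (by rwa [uIcc_of_le zero_le_one])
  have hC : ∫ x in (0:ℝ)..1, (ρ x * (g' x) ^ 2 + V) / 2
      = ((∫ x in (0:ℝ)..1, ρ x * (g' x) ^ 2) + V) / 2 := by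
    rw [intervalIntegral.integral_div, intervalIntegral.integral_add hint (by simp)]
    simp
  rw [hFTC, hC, Real.norm_eq_abs] at hB
  have hx0' : 1 / ρ x0 ≤ 1 := by
    rw [div_le_one (hρpos x0 hx0)]
    exact h1
  intro x hx
  have hxV : 1 / ρ x ≤ V := hmax hx
  have := le_abs_self (V - 1 / ρ x0)
  linarith
end

section
/- Let T > 0 and let ρ, u : [0,1] × [0,T] → ℝ be smooth with ρ > 0, satisfying the continuity equation ρ_t + (ρ u)_x = 0 on (0,1) × (0,T) and the boundary conditions u(0,t) = u(1,t) = 0 for all t. Then for every t ∈ (0,T), d/dt ∫₀¹ ρ(x,t) ( (1/ρ)_x (x,t) )² dx = 2 ∫₀¹ (1/ρ)_x (x,t) · u_{xx}(x,t) dx, where (1/ρ)_x denotes the spatial derivative of 1/ρ and u_{xx} the second spatial derivative of u. -/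
open Set intervalIntegral

noncomputable section

theorem pdx_hasDerivAt {f : ℝ → ℝ → ℝ} (hf : ContDiff ℝ (⊤ : ℕ∞) (fun p : ℝ × ℝ => f p.1 p.2))
    (x t : ℝ) : HasDerivAt (fun y => f y t) (pdx f x t) x := by
  have h : ContDiff ℝ (⊤ : ℕ∞) (fun y : ℝ => f y t) :=
    hf.comp (contDiff_id.prodMk contDiff_const)
  exact (h.differentiable (by simp) x).hasDerivAt

theorem pdt_hasDerivAt {f : ℝ → ℝ → ℝ} (hf : ContDiff ℝ (⊤ : ℕ∞) (fun p : ℝ × ℝ => f p.1 p.2))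
    (x t : ℝ) : HasDerivAt (fun s => f x s) (pdt f x t) t := by
  have h : ContDiff ℝ (⊤ : ℕ∞) (fun s : ℝ => f x s) :=
    hf.comp (contDiff_const.prodMk contDiff_id)
  exact (h.differentiable (by simp) t).hasDerivAt

theorem pdx_eq {f : ℝ → ℝ → ℝ} (hf : ContDiff ℝ (⊤ : ℕ∞) (fun p : ℝ × ℝ => f p.1 p.2))
    (x t : ℝ) : pdx f x t = fderiv ℝ (fun p : ℝ × ℝ => f p.1 p.2) (x, t) (1, 0) := by
  have h1 : HasFDerivAt (fun p : ℝ × ℝ => f p.1 p.2) _ (x, t) :=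
    (hf.differentiable (by simp) (x, t)).hasFDerivAt
  have h2 : HasDerivAt (fun y : ℝ => (y, t)) ((1 : ℝ), (0 : ℝ)) x :=
    (hasDerivAt_id x).prodMk (hasDerivAt_const x t)
  exact (h1.comp_hasDerivAt x h2).deriv

theorem pdt_eq {f : ℝ → ℝ → ℝ} (hf : ContDiff ℝ (⊤ : ℕ∞) (fun p : ℝ × ℝ => f p.1 p.2))
    (x t : ℝ) : pdt f x t = fderiv ℝ (fun p : ℝ × ℝ => f p.1 p.2) (x, t) (0, 1) := by
  have h1 : HasFDerivAt (fun p : ℝ × ℝ => f p.1 p.2) _ (x, t) :=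
    (hf.differentiable (by simp) (x, t)).hasFDerivAt
  have h2 : HasDerivAt (fun y : ℝ => (x, y)) ((0 : ℝ), (1 : ℝ)) t :=
    (hasDerivAt_const t x).prodMk (hasDerivAt_id t)
  exact (h1.comp_hasDerivAt t h2).deriv

theorem pdx_smooth {f : ℝ → ℝ → ℝ} (hf : ContDiff ℝ (⊤ : ℕ∞) (fun p : ℝ × ℝ => f p.1 p.2)) :
    ContDiff ℝ (⊤ : ℕ∞) (fun p : ℝ × ℝ => pdx f p.1 p.2) := by
  simp only [pdx_eq hf]
  exact (hf.fderiv_right (m := (⊤ : ℕ∞)) (by simp)).clm_apply contDiff_const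

theorem pdt_smooth {f : ℝ → ℝ → ℝ} (hf : ContDiff ℝ (⊤ : ℕ∞) (fun p : ℝ × ℝ => f p.1 p.2)) :
    ContDiff ℝ (⊤ : ℕ∞) (fun p : ℝ × ℝ => pdt f p.1 p.2) := by
  simp only [pdt_eq hf]
  exact (hf.fderiv_right (m := (⊤ : ℕ∞)) (by simp)).clm_apply contDiff_const

theorem pd_comm {f : ℝ → ℝ → ℝ} (hf : ContDiff ℝ (⊤ : ℕ∞) (fun p : ℝ × ℝ => f p.1 p.2))
    (x t : ℝ) : pdt (pdx f) x t = pdx (pdt f) x t := by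
  rw [pdt_eq (pdx_smooth hf), pdx_eq (pdt_smooth hf)]
  simp only [pdx_eq hf, pdt_eq hf]
  have hd : DifferentiableAt ℝ (fderiv ℝ (fun p : ℝ × ℝ => f p.1 p.2)) (x, t) :=
    (hf.fderiv_right (m := (⊤ : ℕ∞)) (by simp)).differentiable (by simp) _
  have hs : IsSymmSndFDerivAt ℝ (fun p : ℝ × ℝ => f p.1 p.2) (x, t) :=
    hf.contDiffAt.isSymmSndFDerivAt (by simp only [minSmoothness_of_isRCLikeNormedField]; exact WithTop.coe_le_coe.2 (le_top : (2 : ℕ∞) ≤ ⊤))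
  have e1 := fderiv_clm_apply (𝕜 := ℝ) hd (differentiableAt_const ((1 : ℝ), (0 : ℝ)))
  have e2 := fderiv_clm_apply (𝕜 := ℝ) hd (differentiableAt_const ((0 : ℝ), (1 : ℝ)))
  simp only [Prod.mk.eta] at e1 e2 ⊢
  rw [e1, e2]
  simpa using hs (0, 1) (1, 0)

/-- For a smooth positive density `ρ` and velocity `u` satisfying the
continuity equation `ρ_t + (ρu)_x = 0` on `(0,1) × (0,T)` with `u` vanishing at the
endpoints, the quantity `Q(t) = ∫₀¹ ρ ((1/ρ)_x)²` satisfies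
`d/dt Q(t) = 2 ∫₀¹ (1/ρ)_x u_{xx}` for all `t ∈ (0,T)`. -/
theorem deriv_density_Q_identity
    (T : ℝ) (hT : 0 < T)
    (ρ u : ℝ → ℝ → ℝ)
    (hρ : ContDiff ℝ (⊤ : ℕ∞) (fun p : ℝ × ℝ => ρ p.1 p.2))
    (hu : ContDiff ℝ (⊤ : ℕ∞) (fun p : ℝ × ℝ => u p.1 p.2))
    (hρpos : ∀ x ∈ Icc (0:ℝ) 1, ∀ t ∈ Icc (0:ℝ) T, 0 < ρ x t)
    (hcont : ∀ x ∈ Ioo (0:ℝ) 1, ∀ t ∈ Ioo (0:ℝ) T,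
      pdt ρ x t + pdx (fun y s => ρ y s * u y s) x t = 0)
    (hbdry : ∀ t, u 0 t = 0 ∧ u 1 t = 0) :
    ∀ t ∈ Ioo (0:ℝ) T,
      HasDerivAt
        (fun s => ∫ x in (0:ℝ)..1, ρ x s * (pdx (fun y s' => 1 / ρ y s') x s) ^ 2)
        (2 * ∫ x in (0:ℝ)..1, pdx (fun y s' => 1 / ρ y s') x t * pdx (pdx u) x t)
        t := by
  intro t ht
  have hρx := pdx_smooth hρ
  have hρt := pdt_smooth hρ
  have hρxx := pdx_smooth hρx
  have hρxt := pdt_smooth hρx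
  have hux := pdx_smooth hu
  have huxx := pdx_smooth hux
  have cρ := hρ.continuous
  have cu := hu.continuous
  have cρx := hρx.continuous
  have cρt := hρt.continuous
  have cρxx := hρxx.continuous
  have cρxt := hρxt.continuous
  have cux := hux.continuous
  have cuxx := huxx.continuous
  have hinv : ∀ x ∈ Icc (0:ℝ) 1, ∀ s ∈ Icc (0:ℝ) T,
      pdx (fun y s' => 1 / ρ y s') x s = - pdx ρ x s / ρ x s ^ 2 := by
    intro x hx s hs
    have h := (pdx_hasDerivAt hρ x s).inv (hρpos x hx s hs).ne'
    simp only [pdx, one_div]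
    exact h.deriv
  have hI : uIcc (0:ℝ) 1 = Icc 0 1 := uIcc_of_le zero_le_one
  have hF' : ∀ x ∈ Icc (0:ℝ) 1, ∀ s ∈ Icc (0:ℝ) T,
      HasDerivAt (fun s => pdx ρ x s ^ 2 / ρ x s ^ 3)
        ((2 * pdx ρ x s * pdt (pdx ρ) x s * ρ x s - 3 * pdx ρ x s ^ 2 * pdt ρ x s) / ρ x s ^ 4)
        s := by
    intro x hx s hs
    have hp := (hρpos x hx s hs).ne'
    have h := ((pdt_hasDerivAt hρx x s).pow 2).div ((pdt_hasDerivAt hρ x s).pow 3)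
      (pow_ne_zero 3 hp)
    refine h.congr_deriv ?_
    simp only [Pi.pow_apply]
    field_simp
    push_cast
    ring
  -- differentiate under the integral sign
  obtain ⟨ε, hε, hball⟩ : ∃ ε > 0, Metric.closedBall t ε ⊆ Icc 0 T :=
    Metric.nhds_basis_closedBall.mem_iff.1 (Icc_mem_nhds ht.1 ht.2)
  have htI : t ∈ Icc (0:ℝ) T := Ioo_subset_Icc_self ht
  have hFc : ∀ s ∈ Icc (0:ℝ) T, ContinuousOn (fun x => pdx ρ x s ^ 2 / ρ x s ^ 3) (Icc 0 1) := by
    intro s hs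
    have c1 : Continuous fun x => ρ x s := cρ.comp (continuous_id.prodMk continuous_const)
    have c2 : Continuous fun x => pdx ρ x s := cρx.comp (continuous_id.prodMk continuous_const)
    exact (c2.pow 2).continuousOn.div (c1.pow 3).continuousOn
      fun x hx => pow_ne_zero 3 (hρpos x hx s hs).ne'
  have hF'c : ContinuousOn (fun p : ℝ × ℝ =>
      (2 * pdx ρ p.1 p.2 * pdt (pdx ρ) p.1 p.2 * ρ p.1 p.2
        - 3 * pdx ρ p.1 p.2 ^ 2 * pdt ρ p.1 p.2) / ρ p.1 p.2 ^ 4) (Icc 0 1 ×ˢ Icc 0 T) := by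
    refine ContinuousOn.div ?_ ?_ fun p hp => pow_ne_zero 4 (hρpos p.1 hp.1 p.2 hp.2).ne'
    · exact Continuous.continuousOn (by fun_prop)
    · exact Continuous.continuousOn (by fun_prop)
  obtain ⟨C, hC⟩ := (isCompact_Icc.prod isCompact_Icc).exists_bound_of_continuousOn hF'c
  have hF'ct : ContinuousOn (fun x : ℝ =>
      (2 * pdx ρ x t * pdt (pdx ρ) x t * ρ x t
        - 3 * pdx ρ x t ^ 2 * pdt ρ x t) / ρ x t ^ 4) (Icc 0 1) :=
    hF'c.comp (f := fun x : ℝ => (x, t)) (by fun_prop) fun x hx => ⟨hx, htI⟩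
  have hsub : uIoc (0:ℝ) 1 ⊆ Icc 0 1 := by
    rw [uIoc_of_le zero_le_one]; exact Ioc_subset_Icc_self
  have hmain := (intervalIntegral.hasDerivAt_integral_of_dominated_loc_of_deriv_le
    (μ := MeasureTheory.volume) (a := 0) (b := 1) (x₀ := t) (bound := fun _ => C)
    (F := fun s x => pdx ρ x s ^ 2 / ρ x s ^ 3)
    (F' := fun s x => (2 * pdx ρ x s * pdt (pdx ρ) x s * ρ x s
        - 3 * pdx ρ x s ^ 2 * pdt ρ x s) / ρ x s ^ 4)
    (Metric.closedBall_mem_nhds t hε)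
    (by
      filter_upwards [Icc_mem_nhds ht.1 ht.2] with s hs
      exact ((hFc s hs).mono hsub).aestronglyMeasurable measurableSet_uIoc)
    (ContinuousOn.intervalIntegrable (by rw [hI]; exact hFc t htI))
    ((hF'ct.mono hsub).aestronglyMeasurable measurableSet_uIoc)
    (Filter.Eventually.of_forall fun x hx s hs => hC (x, s) ⟨hsub hx, hball hs⟩)
    intervalIntegrable_const
    (Filter.Eventually.of_forall fun x hx s hs => hF' x (hsub hx) s (hball hs))).2
  have hcongr : (fun s => ∫ x in (0:ℝ)..1, ρ x s * (pdx (fun y s' => 1 / ρ y s') x s) ^ 2)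
      =ᶠ[nhds t] fun s => ∫ x in (0:ℝ)..1, pdx ρ x s ^ 2 / ρ x s ^ 3 := by
    filter_upwards [Icc_mem_nhds ht.1 ht.2] with s hs
    refine intervalIntegral.integral_congr fun x hx => ?_
    rw [hI] at hx
    have hp := (hρpos x hx s hs).ne'
    simp only [hinv x hx s hs]
    field_simp
  refine (hmain.congr_of_eventuallyEq hcongr).congr_deriv ?_
  -- the flux term integrates to zero
  have cρ' : Continuous fun x => ρ x t := cρ.comp (continuous_id.prodMk continuous_const)
  have cρx' : Continuous fun x => pdx ρ x t := cρx.comp (continuous_id.prodMk continuous_const)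
  have cuxx' : Continuous fun x => pdx (pdx u) x t :=
    cuxx.comp (continuous_id.prodMk continuous_const)
  have hGc : ContinuousOn (fun x => 2 * (- pdx ρ x t / ρ x t ^ 2 * pdx (pdx u) x t)) (Icc 0 1) := by
    refine continuousOn_const.mul (ContinuousOn.mul ?_ cuxx'.continuousOn)
    exact cρx'.neg.continuousOn.div (cρ'.pow 2).continuousOn
      fun x hx => pow_ne_zero 2 (hρpos x hx t htI).ne'
  have hct : ∀ x ∈ Ioo (0:ℝ) 1, pdt ρ x t = -(pdx ρ x t * u x t + ρ x t * pdx u x t) := by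
    intro x hx
    have h1 := hcont x hx t ht
    have h2 : pdx (fun y s => ρ y s * u y s) x t = _ :=
      ((pdx_hasDerivAt hρ x t).mul (pdx_hasDerivAt hu x t)).deriv
    rw [h2] at h1
    linarith
  have hcxt : ∀ x ∈ Ioo (0:ℝ) 1, pdt (pdx ρ) x t =
      -(pdx (pdx ρ) x t * u x t + 2 * pdx ρ x t * pdx u x t + ρ x t * pdx (pdx u) x t) := by
    intro x hx
    rw [pd_comm hρ]
    have h1 := (((pdx_hasDerivAt hρx x t).mul (pdx_hasDerivAt hu x t)).add
      ((pdx_hasDerivAt hρ x t).mul (pdx_hasDerivAt hux x t))).neg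
    have h2 : HasDerivAt (fun y => pdt ρ y t) _ x := h1.congr_of_eventuallyEq (by
      filter_upwards [Ioo_mem_nhds hx.1 hx.2] with y hy
      simpa using hct y hy)
    refine h2.deriv.trans ?_
    ring
  have hflux : ∫ x in (0:ℝ)..1, ((2 * pdx ρ x t * pdt (pdx ρ) x t * ρ x t
        - 3 * pdx ρ x t ^ 2 * pdt ρ x t) / ρ x t ^ 4
        - 2 * (- pdx ρ x t / ρ x t ^ 2 * pdx (pdx u) x t)) = 0 := by
    rw [intervalIntegral.integral_eq_sub_of_hasDerivAt_of_le (a := 0) (b := 1)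
      (f := fun x => -(pdx ρ x t ^ 2 / ρ x t ^ 3 * u x t)) zero_le_one]
    · simp [(hbdry t).1, (hbdry t).2]
    · exact ((hFc t htI).mul
        (cu.comp (continuous_id.prodMk continuous_const)).continuousOn).neg
    · intro x hx
      have hp := (hρpos x (Ioo_subset_Icc_self hx) t htI).ne'
      have h := ((((pdx_hasDerivAt hρx x t).pow 2).div ((pdx_hasDerivAt hρ x t).pow 3)
        (pow_ne_zero 3 hp)).mul (pdx_hasDerivAt hu x t)).neg
      refine h.congr_deriv ?_
      rw [hct x hx, hcxt x hx]
      simp only [Pi.pow_apply, Pi.div_apply]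
      field_simp
      push_cast
      ring
    · exact ContinuousOn.intervalIntegrable (by rw [hI]; exact hF'ct.sub hGc)
  rw [intervalIntegral.integral_sub (ContinuousOn.intervalIntegrable (by rw [hI]; exact hF'ct))
    (ContinuousOn.intervalIntegrable (by rw [hI]; exact hGc)), sub_eq_zero] at hflux
  rw [hflux, intervalIntegral.integral_const_mul]
  congr 1
  refine intervalIntegral.integral_congr fun x hx => ?_
  rw [hI] at hx
  simp only [hinv x hx t htI]

end
end
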